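/- Syntactic invertibility of PLK: for every n ∈ ℕ, all formulas A, B, and all finite lists Γ, Δ of formulas: (1) if Γ ⇒ Δ, ¬A has a PLK_n-proof then A, Γ ⇒ Δ has a PLK_n-proof; (2) if ¬A, Γ ⇒ Δ has a PLK_n-proof then Γ ⇒ Δ, A has a PLK_n-proof; (3) if A∧B, Γ ⇒ Δ has a PLK_n-proof then A, B, Γ ⇒ Δ has a PLK_n-proof; (4) if Γ ⇒ Δ, A∧B has a PLK_n-proof then both Γ ⇒ Δ, A and Γ ⇒ Δ, B have PLK_n-proofs; (5) if A∨B, Γ ⇒ Δ has a PLK_n-proof then both A, Γ ⇒ Δ and B, Γ ⇒ Δ have PLK_n-proofs; (6) if Γ ⇒ Δ, A∨B has a PLK_n-proof then Γ ⇒ Δ, A, B has a PLK_n-proof; (7) if A→B, Γ ⇒ Δ has a PLK_n-proof then both Γ ⇒ Δ, A and B, Γ ⇒ Δ have PLK_n-proofs; (8) if Γ ⇒ Δ, A→B has a PLK_n-proof then A, Γ ⇒ Δ, B has a PLK_n-proof. -/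

import Mathlib

/-- Propositional formulas over a countably infinite set of variables. -/
inductive Fml : Type
  | var : ℕ → Fml
  | neg : Fml → Fml
  | conj : Fml → Fml → Fml
  | disj : Fml → Fml → Fml
  | imp : Fml → Fml → Fml
  deriving DecidableEq

/-- Tags for the rules of PLK; the cut tag records the cut formula. -/
inductive PLKRule : Type
  | ax | wl | wr | cl | cr | el | er
  | negL | negR | andL | andR | orL | orR | impL | impR
  | cut : Fml → PLKRule
  deriving DecidableEq

/-- PLK-proofs of sequents (pairs of lists of formulas), where only rules
satisfying `ok` may be used.  `PLKDeriv ok Γ Δ` says the sequent Γ ⇒ Δ has a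
proof tree built from axioms using rules allowed by `ok`. -/
inductive PLKDeriv (ok : PLKRule → Prop) : List Fml → List Fml → Prop
  | ax (n : ℕ) : ok .ax → PLKDeriv ok [.var n] [.var n]
  | wl (A : Fml) (Γ Δ : List Fml) : ok .wl →
      PLKDeriv ok Γ Δ → PLKDeriv ok (A :: Γ) Δ
  | wr (A : Fml) (Γ Δ : List Fml) : ok .wr →
      PLKDeriv ok Γ Δ → PLKDeriv ok Γ (Δ ++ [A])
  | cl (A : Fml) (Γ Δ : List Fml) : ok .cl →
      PLKDeriv ok (A :: A :: Γ) Δ → PLKDeriv ok (A :: Γ) Δ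
  | cr (A : Fml) (Γ Δ : List Fml) : ok .cr →
      PLKDeriv ok Γ (Δ ++ [A, A]) → PLKDeriv ok Γ (Δ ++ [A])
  | el (A B : Fml) (Γ Θ Δ : List Fml) : ok .el →
      PLKDeriv ok (Γ ++ A :: B :: Θ) Δ → PLKDeriv ok (Γ ++ B :: A :: Θ) Δ
  | er (A B : Fml) (Γ Δ Θ : List Fml) : ok .er →
      PLKDeriv ok Γ (Δ ++ A :: B :: Θ) → PLKDeriv ok Γ (Δ ++ B :: A :: Θ)
  | negL (A : Fml) (Γ Δ : List Fml) : ok .negL →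
      PLKDeriv ok Γ (Δ ++ [A]) → PLKDeriv ok (.neg A :: Γ) Δ
  | negR (A : Fml) (Γ Δ : List Fml) : ok .negR →
      PLKDeriv ok (A :: Γ) Δ → PLKDeriv ok Γ (Δ ++ [.neg A])
  | andL₁ (A B : Fml) (Γ Δ : List Fml) : ok .andL →
      PLKDeriv ok (A :: Γ) Δ → PLKDeriv ok (.conj A B :: Γ) Δ
  | andL₂ (A B : Fml) (Γ Δ : List Fml) : ok .andL →
      PLKDeriv ok (B :: Γ) Δ → PLKDeriv ok (.conj A B :: Γ) Δ
  | andR (A B : Fml) (Γ Δ : List Fml) : ok .andR →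
      PLKDeriv ok Γ (Δ ++ [A]) → PLKDeriv ok Γ (Δ ++ [B]) →
      PLKDeriv ok Γ (Δ ++ [.conj A B])
  | orL (A B : Fml) (Γ Δ : List Fml) : ok .orL →
      PLKDeriv ok (A :: Γ) Δ → PLKDeriv ok (B :: Γ) Δ →
      PLKDeriv ok (.disj A B :: Γ) Δ
  | orR₁ (A B : Fml) (Γ Δ : List Fml) : ok .orR →
      PLKDeriv ok Γ (Δ ++ [A]) → PLKDeriv ok Γ (Δ ++ [.disj A B])
  | orR₂ (A B : Fml) (Γ Δ : List Fml) : ok .orR →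
      PLKDeriv ok Γ (Δ ++ [B]) → PLKDeriv ok Γ (Δ ++ [.disj A B])
  | impL (A B : Fml) (Γ Δ : List Fml) : ok .impL →
      PLKDeriv ok Γ (Δ ++ [A]) → PLKDeriv ok (B :: Γ) Δ →
      PLKDeriv ok (.imp A B :: Γ) Δ
  | impR (A B : Fml) (Γ Δ : List Fml) : ok .impR →
      PLKDeriv ok (A :: Γ) (Δ ++ [B]) → PLKDeriv ok Γ (Δ ++ [.imp A B])
  | cut (A : Fml) (Γ Δ : List Fml) : ok (.cut A) →
      PLKDeriv ok Γ (Δ ++ [A]) → PLKDeriv ok (A :: Γ) Δ → PLKDeriv ok Γ Δ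

/-- Γ ⇒ Δ is PLK-provable (all rules allowed). -/
def PLKProvable (Γ Δ : List Fml) : Prop := PLKDeriv (fun _ => True) Γ Δ

/-- The rule `r` is not an instance of cut. -/
def noCut (r : PLKRule) : Prop := ∀ A : Fml, r ≠ PLKRule.cut A

/-- The rule `r` is not an instance of contraction (CL or CR). -/
def noContraction (r : PLKRule) : Prop := r ≠ PLKRule.cl ∧ r ≠ PLKRule.cr

/-- The rule `r` is neither contraction nor cut. -/
def noConNoCut (r : PLKRule) : Prop := noContraction r ∧ noCut r

/-- Complexity of a formula (number of connectives counted as in the paper). -/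
def comp : Fml → ℕ
  | .var _ => 0
  | .neg A => comp A + 1
  | .conj A B => comp A + comp B
  | .disj A B => comp A + comp B
  | .imp A B => comp A + comp B

/-- Rules allowed in a PLK_n-proof: every cut formula has complexity at most n. -/
def PLKdeg (n : ℕ) (r : PLKRule) : Prop := ∀ A : Fml, r = PLKRule.cut A → comp A ≤ n


namespace PLKDeriv

variable {n : ℕ} {Γ Γ' Δ Δ' : List Fml} {A B : Fml}

theorem perm_left (h : Γ.Perm Γ') :
    ∀ Θ : List Fml, PLKDeriv (PLKdeg n) (Θ ++ Γ) Δ → PLKDeriv (PLKdeg n) (Θ ++ Γ') Δ := by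
  induction h with
  | nil => exact fun _ d => d
  | cons x _ ih => intro Θ d; simpa using ih (Θ ++ [x]) (by simpa using d)
  | swap x y l => exact fun Θ d => .el _ _ _ _ _ (by simp [PLKdeg]) d
  | trans _ _ ih₁ ih₂ => exact fun Θ d => ih₂ Θ (ih₁ Θ d)

theorem perm_right (h : Δ.Perm Δ') :
    ∀ Θ : List Fml, PLKDeriv (PLKdeg n) Γ (Θ ++ Δ) → PLKDeriv (PLKdeg n) Γ (Θ ++ Δ') := by
  induction h with
  | nil => exact fun _ d => d
  | cons x _ ih => intro Θ d; simpa using ih (Θ ++ [x]) (by simpa using d)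
  | swap x y l => exact fun Θ d => .er _ _ _ _ _ (by simp [PLKdeg]) d
  | trans _ _ ih₁ ih₂ => exact fun Θ d => ih₂ Θ (ih₁ Θ d)

theorem contract_left (hA : A ∈ Γ) (d : PLKDeriv (PLKdeg n) (A :: Γ) Δ) :
    PLKDeriv (PLKdeg n) Γ Δ := by
  have h := List.perm_cons_erase hA
  exact perm_left h.symm [] (.cl _ _ _ (by simp [PLKdeg]) (perm_left (h.cons A) [] d))

theorem contract_right (hA : A ∈ Δ) (d : PLKDeriv (PLKdeg n) Γ (Δ ++ [A])) :
    PLKDeriv (PLKdeg n) Γ Δ := by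
  have h : Δ.Perm (Δ.erase A ++ [A]) :=
    (List.perm_cons_erase hA).trans (List.perm_append_singleton _ _).symm
  refine perm_right h.symm [] (.cr _ _ _ (by simp [PLKdeg]) ?_)
  simpa using perm_right (h.append_right [A]) [] d

theorem mono_left (h : Γ ⊆ Γ') (d : PLKDeriv (PLKdeg n) Γ Δ) : PLKDeriv (PLKdeg n) Γ' Δ := by
  have weaken : ∀ Θ : List Fml, PLKDeriv (PLKdeg n) (Θ ++ Γ) Δ := by
    intro Θ
    induction Θ with
    | nil => exact d
    | cons A Θ ih => exact .wl _ _ _ (by simp [PLKdeg]) ih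
  have absorb : ∀ Θ : List Fml, Θ ⊆ Γ' → PLKDeriv (PLKdeg n) (Θ ++ Γ') Δ →
      PLKDeriv (PLKdeg n) Γ' Δ := by
    intro Θ hΘ d
    induction Θ with
    | nil => exact d
    | cons A Θ ih =>
      rw [List.cons_subset] at hΘ
      exact ih hΘ.2 (contract_left (List.mem_append_right _ hΘ.1) d)
  exact absorb Γ h (perm_left List.perm_append_comm [] (weaken Γ'))

theorem mono_right (h : Δ ⊆ Δ') (d : PLKDeriv (PLKdeg n) Γ Δ) : PLKDeriv (PLKdeg n) Γ Δ' := by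
  have weaken : ∀ Θ : List Fml, PLKDeriv (PLKdeg n) Γ (Δ ++ Θ) := by
    intro Θ
    induction Θ using List.reverseRecOn with
    | nil => simpa using d
    | append_singleton Θ A ih =>
      simpa using PLKDeriv.wr A _ _ (by simp [PLKdeg]) ih
  have absorb : ∀ Θ : List Fml, Θ ⊆ Δ' → PLKDeriv (PLKdeg n) Γ (Δ' ++ Θ) →
      PLKDeriv (PLKdeg n) Γ Δ' := by
    intro Θ hΘ d
    induction Θ using List.reverseRecOn with
    | nil => simpa using d
    | append_singleton Θ A ih =>
      rw [List.append_subset, List.cons_subset] at hΘ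
      exact ih hΘ.1 (contract_right (List.mem_append_left _ hΘ.2.1) (by simpa using d))
  exact absorb Δ h (perm_right List.perm_append_comm [] (weaken Δ'))

end PLKDeriv

/-- An antecedent formula is covered by `Γ ⇒ Δ` if it occurs in `Γ`, or if `Γ ⇒ Δ` contains the
auxiliary formulas of the invertible left rule for it (for one of the premises). -/
def CoveredLeft (Γ Δ : List Fml) (F : Fml) : Prop :=
  F ∈ Γ ∨ match F with
    | .var _ => False
    | .neg A => A ∈ Δ
    | .conj A B => A ∈ Γ ∧ B ∈ Γ
    | .disj A B => A ∈ Γ ∨ B ∈ Γ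
    | .imp A B => A ∈ Δ ∨ B ∈ Γ

/-- The counterpart of `CoveredLeft` for succedent formulas. -/
def CoveredRight (Γ Δ : List Fml) (F : Fml) : Prop :=
  F ∈ Δ ∨ match F with
    | .var _ => False
    | .neg A => A ∈ Γ
    | .conj A B => A ∈ Δ ∨ B ∈ Δ
    | .disj A B => A ∈ Δ ∧ B ∈ Δ
    | .imp A B => A ∈ Γ ∧ B ∈ Δ

section Covered

variable {n : ℕ} {Γ Γ' Δ Δ' : List Fml} {F : Fml}

theorem CoveredLeft.of_mem (h : F ∈ Γ) : CoveredLeft Γ Δ F := Or.inl h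

theorem CoveredRight.of_mem (h : F ∈ Δ) : CoveredRight Γ Δ F := Or.inl h

theorem CoveredLeft.mono (hΓ : Γ ⊆ Γ') (hΔ : Δ ⊆ Δ') (h : CoveredLeft Γ Δ F) :
    CoveredLeft Γ' Δ' F := by
  cases F <;> grind [CoveredLeft]

theorem CoveredRight.mono (hΓ : Γ ⊆ Γ') (hΔ : Δ ⊆ Δ') (h : CoveredRight Γ Δ F) :
    CoveredRight Γ' Δ' F := by
  cases F <;> grind [CoveredRight]

/-- All formulas of `Γ ⇒ Δ` are covered by `Γ' ⇒ Δ'`. -/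
def Covers (Γ' Δ' Γ Δ : List Fml) : Prop :=
  (∀ F ∈ Γ, CoveredLeft Γ' Δ' F) ∧ ∀ F ∈ Δ, CoveredRight Γ' Δ' F

theorem Covers.cons_left (h : Covers Γ' Δ' Γ Δ) (hF : CoveredLeft Γ' Δ' F) :
    Covers Γ' Δ' (F :: Γ) Δ :=
  ⟨List.forall_mem_cons.2 ⟨hF, h.1⟩, h.2⟩

theorem Covers.append_right (h : Covers Γ' Δ' Γ Δ) (hF : CoveredRight Γ' Δ' F) :
    Covers Γ' Δ' Γ (Δ ++ [F]) :=
  ⟨h.1, List.forall_mem_append.2 ⟨h.2, List.forall_mem_singleton.2 hF⟩⟩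

theorem Covers.add_left (h : Covers Γ' Δ' Γ Δ) : Covers (F :: Γ') Δ' (F :: Γ) Δ :=
  Covers.cons_left
    ⟨fun G hG => (h.1 G hG).mono (List.subset_cons_self _ _) (List.Subset.refl _),
      fun G hG => (h.2 G hG).mono (List.subset_cons_self _ _) (List.Subset.refl _)⟩
    (.of_mem List.mem_cons_self)

theorem Covers.add_right (h : Covers Γ' Δ' Γ Δ) : Covers Γ' (Δ' ++ [F]) Γ (Δ ++ [F]) :=
  Covers.append_right
    ⟨fun G hG => (h.1 G hG).mono (List.Subset.refl _) (List.subset_append_left _ _),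
      fun G hG => (h.2 G hG).mono (List.Subset.refl _) (List.subset_append_left _ _)⟩
    (.of_mem (by simp))

/-- Derivability transfers to every covering sequent, without new cut formulas. -/
theorem PLKDeriv.of_covers (d : PLKDeriv (PLKdeg n) Γ Δ) :
    ∀ {Γ' Δ' : List Fml}, Covers Γ' Δ' Γ Δ → PLKDeriv (PLKdeg n) Γ' Δ' := by
  induction d with
  | ax k hk =>
    rintro Γ' Δ' ⟨hl, hr⟩
    have hl : Fml.var k ∈ Γ' := by simpa [CoveredLeft] using hl
    have hr : Fml.var k ∈ Δ' := by simpa [CoveredRight] using hr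
    exact mono_left (by simpa using hl) (mono_right (by simpa using hr) (.ax k hk))
  | wl A Γ Δ _ _ ih => exact fun h => ih ⟨fun F hF => h.1 F (by simp [hF]), h.2⟩
  | wr A Γ Δ _ _ ih => exact fun h => ih ⟨h.1, fun F hF => h.2 F (by simp [hF])⟩
  | cl A Γ Δ _ _ ih => exact fun h => ih ⟨fun F hF => h.1 F (by simpa using hF), h.2⟩
  | cr A Γ Δ _ _ ih => exact fun h => ih ⟨h.1, fun F hF => h.2 F (by simpa using hF)⟩
  | el A B Γ Θ Δ _ _ ih => exact fun h => ih ⟨fun F hF => h.1 F (by grind), h.2⟩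
  | er A B Γ Θ Δ _ _ ih => exact fun h => ih ⟨h.1, fun F hF => h.2 F (by grind)⟩
  | negL A Γ Δ ok _ ih =>
    rintro Γ' Δ' ⟨hl, hr⟩
    rw [List.forall_mem_cons] at hl
    have h : Covers Γ' Δ' Γ Δ := ⟨hl.2, hr⟩
    obtain hm | hA := hl.1
    · exact contract_left hm (.negL _ _ _ ok (ih h.add_right))
    · exact ih (h.append_right (.of_mem hA))
  | negR A Γ Δ ok _ ih =>
    rintro Γ' Δ' ⟨hl, hr⟩
    rw [List.forall_mem_append, List.forall_mem_singleton] at hr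
    have h : Covers Γ' Δ' Γ Δ := ⟨hl, hr.1⟩
    obtain hm | hA := hr.2
    · exact contract_right hm (.negR _ _ _ ok (ih h.add_left))
    · exact ih (h.cons_left (.of_mem hA))
  | andL₁ A B Γ Δ ok _ ih =>
    rintro Γ' Δ' ⟨hl, hr⟩
    rw [List.forall_mem_cons] at hl
    have h : Covers Γ' Δ' Γ Δ := ⟨hl.2, hr⟩
    obtain hm | ⟨hA, -⟩ := hl.1
    · exact contract_left hm (.andL₁ _ _ _ _ ok (ih h.add_left))
    · exact ih (h.cons_left (.of_mem hA))
  | andL₂ A B Γ Δ ok _ ih =>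
    rintro Γ' Δ' ⟨hl, hr⟩
    rw [List.forall_mem_cons] at hl
    have h : Covers Γ' Δ' Γ Δ := ⟨hl.2, hr⟩
    obtain hm | ⟨-, hB⟩ := hl.1
    · exact contract_left hm (.andL₂ _ _ _ _ ok (ih h.add_left))
    · exact ih (h.cons_left (.of_mem hB))
  | andR A B Γ Δ ok _ _ ihA ihB =>
    rintro Γ' Δ' ⟨hl, hr⟩
    rw [List.forall_mem_append, List.forall_mem_singleton] at hr
    have h : Covers Γ' Δ' Γ Δ := ⟨hl, hr.1⟩
    obtain hm | hA | hB := hr.2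
    · exact contract_right hm (.andR _ _ _ _ ok (ihA h.add_right) (ihB h.add_right))
    · exact ihA (h.append_right (.of_mem hA))
    · exact ihB (h.append_right (.of_mem hB))
  | orL A B Γ Δ ok _ _ ihA ihB =>
    rintro Γ' Δ' ⟨hl, hr⟩
    rw [List.forall_mem_cons] at hl
    have h : Covers Γ' Δ' Γ Δ := ⟨hl.2, hr⟩
    obtain hm | hA | hB := hl.1
    · exact contract_left hm (.orL _ _ _ _ ok (ihA h.add_left) (ihB h.add_left))
    · exact ihA (h.cons_left (.of_mem hA))
    · exact ihB (h.cons_left (.of_mem hB))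
  | orR₁ A B Γ Δ ok _ ih =>
    rintro Γ' Δ' ⟨hl, hr⟩
    rw [List.forall_mem_append, List.forall_mem_singleton] at hr
    have h : Covers Γ' Δ' Γ Δ := ⟨hl, hr.1⟩
    obtain hm | ⟨hA, -⟩ := hr.2
    · exact contract_right hm (.orR₁ _ _ _ _ ok (ih h.add_right))
    · exact ih (h.append_right (.of_mem hA))
  | orR₂ A B Γ Δ ok _ ih =>
    rintro Γ' Δ' ⟨hl, hr⟩
    rw [List.forall_mem_append, List.forall_mem_singleton] at hr
    have h : Covers Γ' Δ' Γ Δ := ⟨hl, hr.1⟩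
    obtain hm | ⟨-, hB⟩ := hr.2
    · exact contract_right hm (.orR₂ _ _ _ _ ok (ih h.add_right))
    · exact ih (h.append_right (.of_mem hB))
  | impL A B Γ Δ ok _ _ ihA ihB =>
    rintro Γ' Δ' ⟨hl, hr⟩
    rw [List.forall_mem_cons] at hl
    have h : Covers Γ' Δ' Γ Δ := ⟨hl.2, hr⟩
    obtain hm | hA | hB := hl.1
    · exact contract_left hm (.impL _ _ _ _ ok (ihA h.add_right) (ihB h.add_left))
    · exact ihA (h.append_right (.of_mem hA))
    · exact ihB (h.cons_left (.of_mem hB))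
  | impR A B Γ Δ ok _ ih =>
    rintro Γ' Δ' ⟨hl, hr⟩
    rw [List.forall_mem_append, List.forall_mem_singleton] at hr
    have h : Covers Γ' Δ' Γ Δ := ⟨hl, hr.1⟩
    obtain hm | ⟨hA, hB⟩ := hr.2
    · exact contract_right hm (.impR _ _ _ _ ok (ih h.add_left.add_right))
    · exact ih ((h.cons_left (.of_mem hA)).append_right (.of_mem hB))
  | cut A Γ Δ ok _ _ ih₁ ih₂ =>
    exact fun h => .cut A _ _ ok (ih₁ h.add_right) (ih₂ h.add_left)

end Covered

/-- syntactic invertibility of PLK, degree-preserving. -/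
theorem stmt_3 (n : ℕ) :
    (∀ (A : Fml) (Γ Δ : List Fml),
      PLKDeriv (PLKdeg n) Γ (Δ ++ [.neg A]) → PLKDeriv (PLKdeg n) (A :: Γ) Δ) ∧
    (∀ (A : Fml) (Γ Δ : List Fml),
      PLKDeriv (PLKdeg n) (.neg A :: Γ) Δ → PLKDeriv (PLKdeg n) Γ (Δ ++ [A])) ∧
    (∀ (A B : Fml) (Γ Δ : List Fml),
      PLKDeriv (PLKdeg n) (.conj A B :: Γ) Δ → PLKDeriv (PLKdeg n) (A :: B :: Γ) Δ) ∧
    (∀ (A B : Fml) (Γ Δ : List Fml),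
      PLKDeriv (PLKdeg n) Γ (Δ ++ [.conj A B]) →
        PLKDeriv (PLKdeg n) Γ (Δ ++ [A]) ∧ PLKDeriv (PLKdeg n) Γ (Δ ++ [B])) ∧
    (∀ (A B : Fml) (Γ Δ : List Fml),
      PLKDeriv (PLKdeg n) (.disj A B :: Γ) Δ →
        PLKDeriv (PLKdeg n) (A :: Γ) Δ ∧ PLKDeriv (PLKdeg n) (B :: Γ) Δ) ∧
    (∀ (A B : Fml) (Γ Δ : List Fml),
      PLKDeriv (PLKdeg n) Γ (Δ ++ [.disj A B]) → PLKDeriv (PLKdeg n) Γ (Δ ++ [A, B])) ∧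
    (∀ (A B : Fml) (Γ Δ : List Fml),
      PLKDeriv (PLKdeg n) (.imp A B :: Γ) Δ →
        PLKDeriv (PLKdeg n) Γ (Δ ++ [A]) ∧ PLKDeriv (PLKdeg n) (B :: Γ) Δ) ∧
    (∀ (A B : Fml) (Γ Δ : List Fml),
      PLKDeriv (PLKdeg n) Γ (Δ ++ [.imp A B]) → PLKDeriv (PLKdeg n) (A :: Γ) (Δ ++ [B])) := by
  refine ⟨?_, ?_, ?_, ?_, ?_, ?_, ?_, ?_⟩ <;> intros <;> (try refine And.intro ?_ ?_) <;>
    refine PLKDeriv.of_covers (by assumption) ⟨?_, ?_⟩ <;>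
    grind [CoveredLeft, CoveredRight, CoveredLeft.of_mem, CoveredRight.of_mem,
      List.mem_cons_self]
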